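/- Let A = (a_{j,q})_{j∈ℕ,q∈ℕ₀} be a Köthe matrix. Then the following are equivalent: (a) A satisfies (i) for every q∈ℕ₀ there is r∈ℕ₀ with a_{j,r}>0 for all j and Σ_{j=1}^∞ a_{j,q}/a_{j,r} < ∞, and (ii) there exists p∈ℕ₀ such that for every q∈ℕ₀ there are r∈ℕ₀ and C>0 with a_{j,q}² ≤ C a_{j,p} a_{j,r} for all j; (b) there exists a topological embedding of λ²(A) into s. -/

import Mathlib

/-- A Köthe matrix: nonnegative entries, for each `j` some `q` with positive entry,
and increasing in `q`. Indices `j ∈ ℕ` (0-based) and `q ∈ ℕ₀`. -/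
def KotheMatrix (a : ℕ → ℕ → ℝ) : Prop :=
  (∀ j q, 0 ≤ a j q) ∧ (∀ j, ∃ q, 0 < a j q) ∧ (∀ j q, a j q ≤ a j (q + 1))

/-- `A ≺ B`: for every `q` there are `r` and `C > 0` with `a j q ≤ C * b j r` for all `j`. -/
def KothePrec (a b : ℕ → ℕ → ℝ) : Prop :=
  ∀ q : ℕ, ∃ r : ℕ, ∃ C : ℝ, 0 < C ∧ ∀ j : ℕ, a j q ≤ C * b j r

/-- `A ~ B`: `A ≺ B` and `B ≺ A`. -/
def KotheEquiv (a b : ℕ → ℕ → ℝ) : Prop :=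
  KothePrec a b ∧ KothePrec b a

/-- The Köthe matrix `A²`, with entries `a j q ^ 2`. -/
def kotheSq (a : ℕ → ℕ → ℝ) : ℕ → ℕ → ℝ := fun j q => a j q ^ 2

/-- The nuclearity condition (Grothendieck–Pietsch): for every `q` there is `r` with
`a j r > 0` for all `j` and `∑ⱼ a j q / a j r < ∞`. -/
def NuclearityCond (a : ℕ → ℕ → ℝ) : Prop :=
  ∀ q : ℕ, ∃ r : ℕ, (∀ j : ℕ, 0 < a j r) ∧ Summable (fun j : ℕ => a j q / a j r)

/-- Membership in the Köthe space `λ²(A)`. -/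
def MemLam2 (a : ℕ → ℕ → ℝ) (ξ : ℕ → ℂ) : Prop :=
  ∀ q : ℕ, Summable (fun j : ℕ => ‖ξ j‖ ^ 2 * a j q ^ 2)

/-- The `q`-th seminorm `|ξ|_{λ²(A),q} = (∑ⱼ |ξ j|² (a j q)²)^{1/2}` of `λ²(A)`. -/
noncomputable def lam2Norm (a : ℕ → ℕ → ℝ) (q : ℕ) (ξ : ℕ → ℂ) : ℝ :=
  Real.sqrt (∑' j : ℕ, ‖ξ j‖ ^ 2 * a j q ^ 2)

/-- Membership in `ℓ²(ℕ, ℂ)`. -/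
def MemEll2 (ξ : ℕ → ℂ) : Prop := Summable (fun j : ℕ => ‖ξ j‖ ^ 2)

/-- The `ℓ²`-norm `‖ξ‖_{ℓ²} = (∑ⱼ |ξ j|²)^{1/2}`. -/
noncomputable def ell2Norm (ξ : ℕ → ℂ) : ℝ := Real.sqrt (∑' j : ℕ, ‖ξ j‖ ^ 2)

/-- The Köthe matrix of the space `s` of rapidly decreasing sequences (0-based indexing,
so the weight is `(j+1)^q`). -/
noncomputable def sMatrix : ℕ → ℕ → ℝ := fun j q => ((j : ℝ) + 1) ^ q

/-- Membership in the space `s` of rapidly decreasing sequences. -/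
def MemS (ξ : ℕ → ℂ) : Prop := MemLam2 sMatrix ξ

/-- The `q`-th norm `|ξ|_q = (∑ⱼ |ξ j|² (j+1)^{2q})^{1/2}` of `s`; note `sNorm 0 = ell2Norm`. -/
noncomputable def sNorm (q : ℕ) (ξ : ℕ → ℂ) : ℝ := lam2Norm sMatrix q ξ

/-- `V` is a topological embedding of the Köthe space `λ²(A)` into `s`
(expressed, as customary for these metrizable locally convex spaces, through the
fundamental systems of seminorms): `V` maps `λ²(A)` into `s`, is injective on `λ²(A)`,
is continuous, and has continuous inverse on its image. -/
def IsTopEmbeddingIntoS (a : ℕ → ℕ → ℝ) (V : (ℕ → ℂ) →ₗ[ℂ] (ℕ → ℂ)) : Prop :=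
  (∀ ξ, MemLam2 a ξ → MemS (V ξ)) ∧
  (∀ ξ, MemLam2 a ξ → V ξ = 0 → ξ = 0) ∧
  (∀ q : ℕ, ∃ r : ℕ, ∃ C : ℝ, 0 < C ∧ ∀ ξ, MemLam2 a ξ → sNorm q (V ξ) ≤ C * lam2Norm a r ξ) ∧
  (∀ q : ℕ, ∃ r : ℕ, ∃ C : ℝ, 0 < C ∧ ∀ ξ, MemLam2 a ξ → lam2Norm a q ξ ≤ C * sNorm r (V ξ))

lemma memLam2_sum_single (a : ℕ → ℕ → ℝ) (J : Finset ℕ) (c : ℕ → ℂ) :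
    MemLam2 a (∑ j ∈ J, Pi.single j (c j)) := by
  intro q
  refine summable_of_ne_finset_zero (s := J) fun i hi => ?_
  have : (∑ j ∈ J, Pi.single j (c j) : ℕ → ℂ) i = 0 := by
    rw [Finset.sum_apply, Finset.sum_pi_single, if_neg hi]
  simp [this]

lemma lam2Norm_sum_single (a : ℕ → ℕ → ℝ) (q : ℕ) (J : Finset ℕ) (c : ℕ → ℂ) :
    lam2Norm a q (∑ j ∈ J, Pi.single j (c j)) = √(∑ j ∈ J, ‖c j‖ ^ 2 * a j q ^ 2) := by
  have happ (i : ℕ) : (∑ j ∈ J, Pi.single j (c j) : ℕ → ℂ) i = if i ∈ J then c i else 0 := by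
    rw [Finset.sum_apply, Finset.sum_pi_single]
  unfold lam2Norm
  rw [tsum_eq_sum (s := J) fun i hi => by simp [happ, hi]]
  congr 1
  exact Finset.sum_congr rfl fun i hi => by rw [happ, if_pos hi]

lemma memLam2_single (a : ℕ → ℕ → ℝ) (j : ℕ) (c : ℂ) : MemLam2 a (Pi.single j c) := by
  simpa using memLam2_sum_single a {j} fun _ => c

lemma lam2Norm_single_one {a : ℕ → ℕ → ℝ} {j q : ℕ} (h : 0 ≤ a j q) :
    lam2Norm a q (Pi.single j 1) = a j q := by
  simpa [Real.sqrt_sq h] using lam2Norm_sum_single a q {j} fun _ => 1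

lemma lam2Norm_nonneg (a : ℕ → ℕ → ℝ) (q : ℕ) (ξ : ℕ → ℂ) : 0 ≤ lam2Norm a q ξ :=
  Real.sqrt_nonneg _

lemma lam2Norm_sq (a : ℕ → ℕ → ℝ) (q : ℕ) (ξ : ℕ → ℂ) :
    lam2Norm a q ξ ^ 2 = ∑' j, ‖ξ j‖ ^ 2 * a j q ^ 2 :=
  Real.sq_sqrt (tsum_nonneg fun _ => by positivity)

lemma norm_mul_pow_le_sNorm {x : ℕ → ℂ} (hx : MemS x) (k r : ℕ) :
    ‖x k‖ * ((k : ℝ) + 1) ^ r ≤ sNorm r x := by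
  refine Real.le_sqrt_of_sq_le ?_
  rw [mul_pow]
  exact (hx r).le_tsum k fun _ _ => by positivity

lemma sNorm_pos {x : ℕ → ℂ} (hx : MemS x) (h : x ≠ 0) (r : ℕ) : 0 < sNorm r x := by
  obtain ⟨k, hk⟩ := Function.ne_iff.mp h
  have : 0 < ‖x k‖ := norm_pos_iff.mpr hk
  exact lt_of_lt_of_le (by positivity) (norm_mul_pow_le_sNorm hx k r)

lemma sNorm_sq_le {x : ℕ → ℂ} (hx : MemS x) (r : ℕ) :
    sNorm r x ^ 2 ≤ sNorm 0 x * sNorm (2 * r) x := by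
  unfold sNorm
  rw [lam2Norm_sq]
  refine Real.tsum_le_of_sum_le (fun _ => by positivity) fun J => ?_
  have h (q : ℕ) : √(∑ j ∈ J, (‖x j‖ * sMatrix j q) ^ 2) ≤ lam2Norm sMatrix q x := by
    refine Real.sqrt_le_sqrt ?_
    simp_rw [mul_pow]
    exact (hx q).sum_le_tsum J fun _ _ => by positivity
  calc ∑ j ∈ J, ‖x j‖ ^ 2 * sMatrix j r ^ 2
      = ∑ j ∈ J, (‖x j‖ * sMatrix j 0) * (‖x j‖ * sMatrix j (2 * r)) := by
        refine Finset.sum_congr rfl fun j _ => ?_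
        simp only [sMatrix]
        ring
    _ ≤ _ := Real.sum_mul_le_sqrt_mul_sqrt _ _ _
    _ ≤ _ := mul_le_mul (h 0) (h _) (Real.sqrt_nonneg _) (lam2Norm_nonneg _ _ _)

lemma sum_norm_sq_coord_le {a : ℕ → ℕ → ℝ} {V : (ℕ → ℂ) →ₗ[ℂ] (ℕ → ℂ)} {r t : ℕ} {C : ℝ}
    (hmem : ∀ ξ, MemLam2 a ξ → MemS (V ξ)) (hpos : ∀ j, 0 < a j t)
    (hC : ∀ ξ, MemLam2 a ξ → sNorm r (V ξ) ≤ C * lam2Norm a t ξ) (k : ℕ) (J : Finset ℕ) :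
    (∑ j ∈ J, ‖V (Pi.single j 1) k‖ ^ 2 / a j t ^ 2) * (((k : ℝ) + 1) ^ r) ^ 2 ≤ C ^ 2 := by
  set S := ∑ j ∈ J, ‖V (Pi.single j 1) k‖ ^ 2 / a j t ^ 2 with hS
  have hS0 : 0 ≤ S := Finset.sum_nonneg fun _ _ => by positivity
  set c : ℕ → ℂ := fun j => (starRingEnd ℂ) (V (Pi.single j 1) k) / ((a j t ^ 2 : ℝ) : ℂ) with hc
  have hmemξ := memLam2_sum_single a J c
  have hnorm : lam2Norm a t (∑ j ∈ J, Pi.single j (c j)) = √S := by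
    rw [lam2Norm_sum_single]
    congr 1
    refine Finset.sum_congr rfl fun j _ => ?_
    have := (hpos j).ne'
    simp only [hc, norm_div, RCLike.norm_conj, Complex.norm_real, Real.norm_eq_abs,
      abs_of_nonneg (sq_nonneg (a j t))]
    field_simp
  have hV : V (∑ j ∈ J, Pi.single j (c j)) k = (S : ℂ) := by
    rw [map_sum, Finset.sum_apply, hS, Complex.ofReal_sum]
    refine Finset.sum_congr rfl fun j _ => ?_
    have hsm : (Pi.single j (c j) : ℕ → ℂ) = c j • Pi.single j 1 := by
      rw [← Pi.single_smul, smul_eq_mul, mul_one]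
    rw [hsm, map_smul, Pi.smul_apply, smul_eq_mul]
    simp only [hc]
    rw [div_mul_eq_mul_div, Complex.conj_mul']
    push_cast
    rfl
  have key := (norm_mul_pow_le_sNorm (hmem _ hmemξ) k r).trans (hC _ hmemξ)
  rw [hV, hnorm, Complex.norm_real, Real.norm_of_nonneg hS0] at key
  rcases hS0.eq_or_lt with h0 | h0
  · rw [← h0, zero_mul]
    positivity
  · have hs : 0 < √S := Real.sqrt_pos.mpr h0
    have h1 : √S * ((k : ℝ) + 1) ^ r ≤ C := by
      refine le_of_mul_le_mul_left ?_ hs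
      calc √S * (√S * ((k : ℝ) + 1) ^ r) = S * ((k : ℝ) + 1) ^ r := by
            rw [← mul_assoc, Real.mul_self_sqrt hS0]
        _ ≤ C * √S := key
        _ = √S * C := mul_comm _ _
    calc S * (((k : ℝ) + 1) ^ r) ^ 2 = (√S * ((k : ℝ) + 1) ^ r) ^ 2 := by
          rw [mul_pow, Real.sq_sqrt hS0]
      _ ≤ C ^ 2 := pow_le_pow_left₀ (by positivity) h1 2

lemma exists_summable_sq_div {a : ℕ → ℕ → ℝ} (hA : KotheMatrix a)
    {V : (ℕ → ℂ) →ₗ[ℂ] (ℕ → ℂ)} (hV : IsTopEmbeddingIntoS a V) (q : ℕ) :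
    ∃ t, (∀ j, 0 < a j t) ∧ Summable fun j => (a j q / a j t) ^ 2 := by
  obtain ⟨hmem, hinj, hcont, hinv⟩ := hV
  obtain ⟨r, B, hB, hqr⟩ := hinv q
  obtain ⟨t, C, hC, hrt⟩ := hcont (r + 1)
  have hpos (j : ℕ) : 0 < a j t := by
    have hm := memLam2_single a j 1
    have hne : V (Pi.single j 1) ≠ 0 := fun h => by simpa using hinj _ hm h
    have := (sNorm_pos (hmem _ hm) hne (r + 1)).trans_le (hrt _ hm)
    rw [lam2Norm_single_one (hA.1 j t)] at this
    exact pos_of_mul_pos_right this hC.le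
  have hsum : Summable fun k : ℕ => 1 / ((k : ℝ) + 1) ^ 2 := by
    simpa using (summable_nat_add_iff 1).mpr (Real.summable_one_div_nat_pow.mpr one_lt_two)
  refine ⟨t, hpos, summable_of_sum_le (c := B ^ 2 * (C ^ 2 * ∑' k : ℕ, 1 / ((k : ℝ) + 1) ^ 2))
    (fun _ => sq_nonneg _) fun J => ?_⟩
  have hterm (j : ℕ) : Summable fun k : ℕ =>
      ‖V (Pi.single j 1) k‖ ^ 2 * sMatrix k r ^ 2 / a j t ^ 2 :=
    (hmem _ (memLam2_single a j 1) r).div_const _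
  calc ∑ j ∈ J, (a j q / a j t) ^ 2
      ≤ ∑ j ∈ J, B ^ 2 * ∑' k, ‖V (Pi.single j 1) k‖ ^ 2 * sMatrix k r ^ 2 / a j t ^ 2 := by
        refine Finset.sum_le_sum fun j _ => ?_
        have h := hqr _ (memLam2_single a j 1)
        rw [lam2Norm_single_one (hA.1 j q)] at h
        have h2 := pow_le_pow_left₀ (hA.1 j q) h 2
        rw [mul_pow, sNorm, lam2Norm_sq] at h2
        rw [tsum_div_const, ← mul_div_assoc, div_pow]
        gcongr
    _ = B ^ 2 * ∑' k, ∑ j ∈ J, ‖V (Pi.single j 1) k‖ ^ 2 * sMatrix k r ^ 2 / a j t ^ 2 := by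
        rw [← Finset.mul_sum, Summable.tsum_finsetSum fun j _ => hterm j]
    _ ≤ B ^ 2 * (C ^ 2 * ∑' k : ℕ, 1 / ((k : ℝ) + 1) ^ 2) := by
        rw [← tsum_mul_left (a := C ^ 2)]
        refine mul_le_mul_of_nonneg_left ?_ (sq_nonneg B)
        refine (summable_sum fun j _ => hterm j).tsum_le_tsum (fun k => ?_) (hsum.mul_left _)
        have h := sum_norm_sq_coord_le hmem hpos hrt k J
        have hk : 0 < (k : ℝ) + 1 := by positivity
        rw [mul_one_div, le_div_iff₀ (by positivity)]
        refine le_trans (le_of_eq ?_) h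
        rw [Finset.sum_mul, Finset.sum_mul]
        refine Finset.sum_congr rfl fun j _ => ?_
        simp only [sMatrix]
        ring

lemma nuclearityCond_of_embedding {a : ℕ → ℕ → ℝ} (hA : KotheMatrix a)
    {V : (ℕ → ℂ) →ₗ[ℂ] (ℕ → ℂ)} (hV : IsTopEmbeddingIntoS a V) : NuclearityCond a := by
  intro q
  obtain ⟨t, htpos, ht⟩ := exists_summable_sq_div hA hV q
  obtain ⟨u, hupos, hu⟩ := exists_summable_sq_div hA hV t
  refine ⟨u, hupos, Summable.of_nonneg_of_le (fun j => div_nonneg (hA.1 _ _) (hA.1 _ _))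
    (fun j => ?_) (ht.add hu)⟩
  have h : a j q / a j u = a j q / a j t * (a j t / a j u) :=
    (div_mul_div_cancel₀ (htpos j).ne').symm
  rw [h]
  nlinarith [sq_nonneg (a j q / a j t - a j t / a j u), sq_nonneg (a j q / a j t),
    sq_nonneg (a j t / a j u)]

lemma dominatingNorm_of_embedding {a : ℕ → ℕ → ℝ} (hA : KotheMatrix a)
    {V : (ℕ → ℂ) →ₗ[ℂ] (ℕ → ℂ)} (hV : IsTopEmbeddingIntoS a V) :
    ∃ p : ℕ, ∀ q : ℕ, ∃ r : ℕ, ∃ C : ℝ, 0 < C ∧ ∀ j : ℕ, a j q ^ 2 ≤ C * a j p * a j r := by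
  obtain ⟨hmem, -, hcont, hinv⟩ := hV
  obtain ⟨p, C₀, hC₀, hp⟩ := hcont 0
  refine ⟨p, fun q => ?_⟩
  obtain ⟨r, B, hB, hqr⟩ := hinv q
  obtain ⟨t, C, hC, hrt⟩ := hcont (2 * r)
  refine ⟨t, B ^ 2 * (C₀ * C), by positivity, fun j => ?_⟩
  have hm := memLam2_single a j 1
  have h1 := hqr _ hm
  have h2 := hp _ hm
  have h3 := hrt _ hm
  rw [lam2Norm_single_one (hA.1 _ _)] at h1 h2 h3
  have h4 := sNorm_sq_le (hmem _ hm) r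
  calc a j q ^ 2 ≤ (B * sNorm r (V (Pi.single j 1))) ^ 2 := pow_le_pow_left₀ (hA.1 _ _) h1 2
    _ = B ^ 2 * sNorm r (V (Pi.single j 1)) ^ 2 := mul_pow _ _ _
    _ ≤ B ^ 2 * (sNorm 0 (V (Pi.single j 1)) * sNorm (2 * r) (V (Pi.single j 1))) := by gcongr
    _ ≤ B ^ 2 * ((C₀ * a j p) * (C * a j t)) := by
        refine mul_le_mul_of_nonneg_left ?_ (sq_nonneg B)
        exact mul_le_mul h2 h3 (lam2Norm_nonneg _ _ _) (mul_nonneg hC₀.le (hA.1 _ _))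
    _ = _ := by ring

/-- A family of weights `≥ 1` with summable reciprocals is polynomially comparable to an
injective family of natural numbers. -/
lemma exists_injective_nat_comparable {ι : Type*} {w : ι → ℝ} (hw : ∀ x, 1 ≤ w x)
    (hsum : Summable fun x => 1 / w x) :
    ∃ n : ι → ℕ, Function.Injective n ∧ ∃ C : ℝ, 0 < C ∧
      ∀ x, w x ≤ (n x : ℝ) + 1 ∧ (n x : ℝ) + 1 ≤ C * w x ^ 2 := by
  obtain ⟨K, hK⟩ := exists_nat_ge (∑' x, 1 / w x)
  have hcard (N : ℕ) (T : Finset ι) (hT : ∀ x ∈ T, ⌈w x⌉₊ = N) : T.card ≤ K * N := by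
    have h1 : (T.card : ℝ) ≤ (∑ x ∈ T, 1 / w x) * N := by
      rw [Finset.sum_mul, Finset.card_eq_sum_ones, Nat.cast_sum]
      refine Finset.sum_le_sum fun x hx => ?_
      have h0 : 0 < w x := one_pos.trans_le (hw x)
      have h2 : w x ≤ N := hT x hx ▸ Nat.le_ceil (w x)
      rw [div_mul_eq_mul_div, le_div_iff₀ h0]
      simpa using h2
    have h2 : ∑ x ∈ T, 1 / w x ≤ K := (hsum.sum_le_tsum T fun x _ =>
      one_div_nonneg.mpr (zero_le_one.trans (hw x))).trans hK
    have h3 : (T.card : ℝ) ≤ K * N := h1.trans (by gcongr)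
    exact_mod_cast h3
  have hfin (N : ℕ) : {x | ⌈w x⌉₊ = N}.Finite := by
    by_contra h
    obtain ⟨T, hT, hTc⟩ := Set.Infinite.exists_subset_card_eq h (K * N + 1)
    have := hcard N T fun x hx => hT hx
    omega
  have hemb (N : ℕ) : ∃ e : ι → ℕ, Set.InjOn e {x | ⌈w x⌉₊ = N} ∧
      ∀ x, ⌈w x⌉₊ = N → e x < K * N := by
    have hc : {x | ⌈w x⌉₊ = N}.encard ≤ (Finset.range (K * N) : Set ℕ).encard := by
      rw [(hfin N).encard_eq_coe_toFinset_card, Set.encard_coe_eq_coe_finsetCard,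
        Finset.card_range]
      exact_mod_cast hcard N _ fun x hx => by simpa using hx
    obtain ⟨e, hsub, hinj⟩ := (hfin N).exists_injOn_of_encard_le hc
    exact ⟨e, hinj, fun x hx => Finset.mem_range.mp (Finset.mem_coe.mp (hsub hx))⟩
  choose e he hlt using hemb
  refine ⟨fun x => Nat.pair ⌈w x⌉₊ (e ⌈w x⌉₊ x), fun x y hxy => ?_,
    4 * ((K : ℝ) + 2) ^ 2, by positivity, fun x => ⟨?_, ?_⟩⟩
  · obtain ⟨h1, h2⟩ := Nat.pair_eq_pair.mp hxy
    rw [← h1] at h2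
    exact he _ rfl h1.symm h2
  · have h1 := Nat.le_ceil (w x)
    have h2 : (⌈w x⌉₊ : ℝ) ≤ (Nat.pair ⌈w x⌉₊ (e ⌈w x⌉₊ x) : ℕ) := by
      exact_mod_cast Nat.left_le_pair _ _
    linarith
  · set N := ⌈w x⌉₊
    have hN : (N : ℝ) ≤ 2 * w x := by
      have := Nat.ceil_lt_add_one (zero_le_one.trans (hw x))
      linarith [hw x]
    have h1 : Nat.pair N (e N x) + 1 ≤ (max N (e N x) + 1) ^ 2 := Nat.pair_lt_max_add_one_sq _ _
    have h2 : max N (e N x) + 1 ≤ (K + 1) * N + 1 := by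
      have := hlt N x rfl
      have h3 : max N (e N x) ≤ (K + 1) * N := by
        refine max_le ?_ ?_ <;> nlinarith
      omega
    have h3 : (Nat.pair N (e N x) : ℝ) + 1 ≤ (((K : ℝ) + 1) * N + 1) ^ 2 := by
      exact_mod_cast h1.trans (Nat.pow_le_pow_left h2 2)
    calc (Nat.pair N (e N x) : ℝ) + 1 ≤ (((K : ℝ) + 1) * N + 1) ^ 2 := h3
      _ ≤ (2 * ((K : ℝ) + 2) * w x) ^ 2 := by
          refine pow_le_pow_left₀ (by positivity) ?_ 2
          nlinarith [hw x, (Nat.cast_nonneg K : (0 : ℝ) ≤ K)]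
      _ = _ := by ring

/-- Under nuclearity and the dominating norm condition, the norms of `λ²(A)` are, up to a
diagonal transformation, given by weights `w` which at least square from each step to the next. -/
lemma exists_squaring_weights {a : ℕ → ℕ → ℝ} (hA : KotheMatrix a) (hN : NuclearityCond a)
    (hD : ∃ p : ℕ, ∀ q : ℕ, ∃ r : ℕ, ∃ C : ℝ, 0 < C ∧
      ∀ j : ℕ, a j q ^ 2 ≤ C * a j p * a j r) :
    ∃ (b : ℕ → ℝ) (w : ℕ → ℕ → ℝ) (σ : ℕ → ℕ) (D : ℕ → ℝ),
      (∀ j, 0 < b j) ∧ (∀ k, k ≤ σ k) ∧ (∀ k, 0 < D k) ∧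
      (∀ j k, b j * w j k = D k * a j (σ k)) ∧ (∀ j, 2 ≤ w j 0) ∧
      (∀ j k, w j k ^ 2 ≤ w j (k + 1)) ∧ Summable fun j => 1 / w j 0 := by
  obtain ⟨p, hp⟩ := hD
  choose r C hC hr using hp
  have hmono (j : ℕ) : Monotone (a j) := monotone_nat_of_le_succ (hA.2.2 j)
  have hb (j : ℕ) : 0 < a j p := by
    obtain ⟨q, hq⟩ := hA.2.1 j
    refine lt_of_le_of_ne (hA.1 j p) fun h => ?_
    have := hr q j
    rw [← h, mul_zero, zero_mul] at this
    exact absurd this (not_le.mpr (by positivity))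
  obtain ⟨r₀, hr₀, hsum⟩ := hN p
  set M := ∑' j, a j p / a j r₀
  have hM (j : ℕ) : a j p / a j r₀ ≤ M :=
    hsum.le_tsum j fun i _ => div_nonneg (hA.1 _ _) (hA.1 _ _)
  have hM0 : 0 < M := lt_of_lt_of_le (div_pos (hb 0) (hr₀ 0)) (hM 0)
  let s : ℕ → ℕ × ℝ := fun k => Nat.rec (r₀, 2 * M)
    (fun _ x => (max (r x.1) (x.1 + 1), x.2 ^ 2 * C x.1)) k
  have hs0 : s 0 = (r₀, 2 * M) := rfl
  have hs (k : ℕ) : s (k + 1) = (max (r (s k).1) ((s k).1 + 1), (s k).2 ^ 2 * C (s k).1) := rfl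
  have hDpos (k : ℕ) : 0 < (s k).2 := by
    induction k with
    | zero => rw [hs0]; positivity
    | succ k ih => rw [hs]; exact mul_pos (pow_pos ih 2) (hC _)
  refine ⟨fun j => a j p, fun j k => (s k).2 * a j (s k).1 / a j p, fun k => (s k).1,
    fun k => (s k).2, hb, fun k => ?_, hDpos, fun j k => mul_div_cancel₀ _ (hb j).ne',
    fun j => ?_, fun j k => ?_, ?_⟩
  · induction k with
    | zero => exact Nat.zero_le _
    | succ k ih =>
      simp only [hs]
      exact (Nat.succ_le_succ ih).trans (le_max_right _ _)
  · have h := hM j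
    rw [div_le_iff₀ (hr₀ j)] at h
    simp only [hs0]
    rw [le_div_iff₀ (hb j)]
    linarith
  · have h1 := hr (s k).1 j
    have h2 : a j (r (s k).1) ≤ a j (s (k + 1)).1 := hmono j (by rw [hs]; exact le_max_left _ _)
    have h3 : (s (k + 1)).2 = (s k).2 ^ 2 * C (s k).1 := by rw [hs]
    have hbj := hb j
    rw [div_pow, div_le_div_iff₀ (by positivity) hbj, mul_pow, h3]
    calc (s k).2 ^ 2 * a j (s k).1 ^ 2 * a j p
        ≤ (s k).2 ^ 2 * (C (s k).1 * a j p * a j (s (k + 1)).1) * a j p := by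
          have := h1.trans (mul_le_mul_of_nonneg_left h2 (mul_nonneg (hC _).le hbj.le))
          gcongr
      _ = _ := by ring
  · refine (hsum.mul_left (1 / (2 * M))).congr fun j => ?_
    have := (hr₀ j).ne'
    have := (hb j).ne'
    simp only [hs0]
    field_simp

lemma two_le_of_squaring {w : ℕ → ℝ} (h0 : 2 ≤ w 0)
    (hsq : ∀ k, w k ^ 2 ≤ w (k + 1)) (k : ℕ) : 2 ≤ w k := by
  induction k with
  | zero => exact h0
  | succ k ih => nlinarith [hsq k]

lemma two_pow_mul_le_of_squaring {w : ℕ → ℝ} (h0 : 2 ≤ w 0)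
    (hsq : ∀ k, w k ^ 2 ≤ w (k + 1)) (k : ℕ) : 2 ^ k * w 0 ≤ w k := by
  induction k with
  | zero => simp
  | succ k ih => nlinarith [hsq k, two_le_of_squaring h0 hsq k, pow_succ (2 : ℝ) k]

lemma monotone_of_squaring {w : ℕ → ℝ} (h0 : 2 ≤ w 0)
    (hsq : ∀ k, w k ^ 2 ≤ w (k + 1)) : Monotone w :=
  monotone_nat_of_le_succ fun k => by nlinarith [hsq k, two_le_of_squaring h0 hsq k]

lemma pow_self_le_of_squaring {w : ℕ → ℝ} (h0 : 2 ≤ w 0)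
    (hsq : ∀ k, w k ^ 2 ≤ w (k + 1)) (k : ℕ) : w k ^ k ≤ w (2 * k) := by
  have h (m : ℕ) : w k ^ (2 ^ m) ≤ w (k + m) := by
    induction m with
    | zero => simp
    | succ m ih =>
      have h2 := two_le_of_squaring h0 hsq k
      calc w k ^ (2 ^ (m + 1)) = (w k ^ (2 ^ m)) ^ 2 := by rw [pow_succ, pow_mul]
        _ ≤ w (k + m) ^ 2 := pow_le_pow_left₀ (by positivity) ih 2
        _ ≤ w (k + (m + 1)) := hsq _
  have h2 := two_le_of_squaring h0 hsq k
  rw [two_mul]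
  exact (pow_le_pow_right₀ (by linarith) Nat.lt_two_pow_self.le).trans (h k)

lemma div_pow_mul_pow_le_of_squaring {w : ℕ → ℝ} (h0 : 2 ≤ w 0)
    (hsq : ∀ k, w k ^ 2 ≤ w (k + 1)) (q i : ℕ) :
    w i / w i ^ i * (w i ^ 2) ^ q ≤ w (2 * (2 * q + 2)) * (1 / 2) ^ i := by
  have hi := two_le_of_squaring h0 hsq i
  have hR := two_le_of_squaring h0 hsq (2 * (2 * q + 2))
  have h2i : (2 : ℝ) ^ i ≤ w i := by
    have := two_pow_mul_le_of_squaring h0 hsq i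
    nlinarith [pow_pos (two_pos : (0 : ℝ) < 2) i]
  have key : w i ^ (2 * q + 2) ≤ w (2 * (2 * q + 2)) * w i ^ i := by
    have hone : 1 ≤ w i ^ i := one_le_pow₀ (by linarith)
    rcases le_total i (2 * q + 2) with h | h
    · calc w i ^ (2 * q + 2) ≤ w (2 * q + 2) ^ (2 * q + 2) :=
            pow_le_pow_left₀ (by linarith) (monotone_of_squaring h0 hsq h) _
        _ ≤ w (2 * (2 * q + 2)) := pow_self_le_of_squaring h0 hsq _
        _ ≤ _ := le_mul_of_one_le_right (by linarith) hone
    · calc w i ^ (2 * q + 2) ≤ w i ^ i := pow_le_pow_right₀ (by linarith) h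
        _ ≤ _ := le_mul_of_one_le_left (by linarith) (by linarith)
  rw [one_div, inv_pow, ← div_eq_mul_inv, div_mul_eq_mul_div,
    div_le_div_iff₀ (by positivity) (by positivity)]
  refine le_trans ?_ key
  calc w i * (w i ^ 2) ^ q * 2 ^ i ≤ w i * (w i ^ 2) ^ q * w i := by gcongr
    _ = w i ^ (2 * q + 2) := by ring

lemma exists_embedding {a : ℕ → ℕ → ℝ} (hA : KotheMatrix a) {b : ℕ → ℝ} {w : ℕ → ℕ → ℝ}
    {σ : ℕ → ℕ} {D : ℕ → ℝ} (hb : ∀ j, 0 < b j) (hσ : ∀ k, k ≤ σ k) (hD : ∀ k, 0 < D k)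
    (hbw : ∀ j k, b j * w j k = D k * a j (σ k)) (h0 : ∀ j, 2 ≤ w j 0)
    (hsq : ∀ j k, w j k ^ 2 ≤ w j (k + 1)) (hsum : Summable fun j => 1 / w j 0) :
    ∃ V : (ℕ → ℂ) →ₗ[ℂ] (ℕ → ℂ), IsTopEmbeddingIntoS a V := by
  have hw2 (j k : ℕ) : 2 ≤ w j k := two_le_of_squaring (h0 j) (hsq j) k
  have hwpos (j k : ℕ) : 0 < w j k := two_pos.trans_le (hw2 j k)
  have hgeom : Summable fun i : ℕ => (1 / 2 : ℝ) ^ i := summable_geometric_two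
  have hsum2 : Summable fun x : ℕ × ℕ => 1 / w x.1 x.2 := by
    refine Summable.of_nonneg_of_le (fun x => (one_div_pos.mpr (hwpos _ _)).le) (fun x => ?_)
      (hsum.mul_of_nonneg hgeom (fun j => (one_div_pos.mpr (hwpos _ _)).le)
        fun i => by positivity)
    have h1 := two_pow_mul_le_of_squaring (h0 x.1) (hsq x.1) x.2
    have h2 := hwpos x.1 0
    rw [one_div_pow, one_div_mul_one_div]
    exact one_div_le_one_div_of_le (by positivity) (by linarith)
  obtain ⟨n, hn, C, hC, hnw⟩ := exists_injective_nat_comparable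
    (fun x : ℕ × ℕ => by linarith [hw2 x.1 x.2]) hsum2
  let c : ℕ × ℕ → ℝ := fun x => b x.1 * (w x.1 x.2 / w x.1 x.2 ^ x.2)
  have hc (x : ℕ × ℕ) : 0 < c x :=
    mul_pos (hb _) (div_pos (hwpos _ _) (pow_pos (hwpos _ _) _))
  let L : (ℕ → ℂ) →ₗ[ℂ] (ℕ × ℕ → ℂ) :=
    LinearMap.pi fun x => (c x : ℂ) • LinearMap.proj x.1
  let V : (ℕ → ℂ) →ₗ[ℂ] (ℕ → ℂ) := (Function.ExtendByZero.linearMap ℂ n).comp L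
  have hVn (ξ : ℕ → ℂ) (x : ℕ × ℕ) : V ξ (n x) = c x * ξ x.1 := hn.extend_apply _ _ _
  have hV0 (ξ : ℕ → ℂ) (m : ℕ) (hm : m ∉ Set.range n) : V ξ m = 0 :=
    Function.extend_apply' _ _ _ hm
  let T : ℕ → (ℕ → ℂ) → ℕ × ℕ → ℝ :=
    fun q ξ x => ‖ξ x.1‖ ^ 2 * (c x * ((n x : ℝ) + 1) ^ q) ^ 2
  have hcomp (q : ℕ) (ξ : ℕ → ℂ) :
      (fun m => ‖V ξ m‖ ^ 2 * sMatrix m q ^ 2) ∘ n = T q ξ := by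
    funext x
    simp only [T, Function.comp_apply, hVn, norm_mul, Complex.norm_real,
      Real.norm_of_nonneg (hc x).le, sMatrix]
    ring
  have hsupp (q : ℕ) (ξ : ℕ → ℂ) (m : ℕ) (hm : m ∉ Set.range n) :
      ‖V ξ m‖ ^ 2 * sMatrix m q ^ 2 = 0 := by simp [hV0 ξ m hm]
  have hsummable (q : ℕ) (ξ : ℕ → ℂ) :
      (Summable fun m => ‖V ξ m‖ ^ 2 * sMatrix m q ^ 2) ↔ Summable (T q ξ) := by
    rw [← hcomp, hn.summable_iff (hsupp q ξ)]
  have hsNorm (q : ℕ) (ξ : ℕ → ℂ) : sNorm q (V ξ) = √(∑' x, T q ξ x) := by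
    unfold sNorm lam2Norm
    rw [← hcomp]
    congr 1
    refine (hn.tsum_eq fun m hm => ?_).symm
    by_contra h
    exact hm (hsupp q ξ m h)
  let R : ℕ → ℕ := fun q => 2 * (2 * q + 2)
  let B : ℕ → ℝ := fun q => C ^ q * D (R q)
  have hBpos (q : ℕ) : 0 < B q := mul_pos (pow_pos hC q) (hD _)
  have hupper (q : ℕ) (x : ℕ × ℕ) :
      c x * ((n x : ℝ) + 1) ^ q ≤ B q * a x.1 (σ (R q)) * (1 / 2) ^ x.2 := by
    have h1 := div_pow_mul_pow_le_of_squaring (h0 x.1) (hsq x.1) q x.2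
    calc c x * ((n x : ℝ) + 1) ^ q ≤ c x * (C * w x.1 x.2 ^ 2) ^ q :=
          mul_le_mul_of_nonneg_left (pow_le_pow_left₀ (by positivity) (hnw x).2 q) (hc x).le
      _ = C ^ q * b x.1 * (w x.1 x.2 / w x.1 x.2 ^ x.2 * (w x.1 x.2 ^ 2) ^ q) := by
          simp only [c]
          ring
      _ ≤ C ^ q * b x.1 * (w x.1 (R q) * (1 / 2) ^ x.2) :=
          mul_le_mul_of_nonneg_left h1 (mul_nonneg (pow_nonneg hC.le q) (hb _).le)
      _ = C ^ q * (b x.1 * w x.1 (R q)) * (1 / 2) ^ x.2 := by ring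
      _ = _ := by
          rw [hbw]
          simp only [B]
          ring
  have hTle (q : ℕ) (ξ : ℕ → ℂ) (x : ℕ × ℕ) :
      T q ξ x ≤ B q ^ 2 * ((‖ξ x.1‖ ^ 2 * a x.1 (σ (R q)) ^ 2) * (1 / 4) ^ x.2) := by
    have h := pow_le_pow_left₀ (mul_nonneg (hc x).le (by positivity)) (hupper q x) 2
    calc T q ξ x ≤ ‖ξ x.1‖ ^ 2 * (B q * a x.1 (σ (R q)) * (1 / 2) ^ x.2) ^ 2 :=
          mul_le_mul_of_nonneg_left h (sq_nonneg _)
      _ = _ := by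
          rw [mul_pow, ← pow_mul, mul_comm x.2 2, pow_mul]
          norm_num
          ring
  have hgeom4 : HasSum (fun i : ℕ => (1 / 4 : ℝ) ^ i) (4 / 3) := by
    have := hasSum_geometric_of_lt_one (r := (1 / 4 : ℝ)) (by norm_num) (by norm_num)
    norm_num at this ⊢
    exact this
  have hprod (q : ℕ) {ξ : ℕ → ℂ} (hξ : MemLam2 a ξ) : Summable fun x : ℕ × ℕ =>
      (‖ξ x.1‖ ^ 2 * a x.1 (σ (R q)) ^ 2) * (1 / 4 : ℝ) ^ x.2 :=
    (hξ (σ (R q))).mul_of_nonneg hgeom4.summable (fun _ => by positivity)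
      fun _ => by positivity
  have hT0 (q : ℕ) (ξ : ℕ → ℂ) (x : ℕ × ℕ) : 0 ≤ T q ξ x := by positivity
  have hTsum (q : ℕ) {ξ : ℕ → ℂ} (hξ : MemLam2 a ξ) : Summable (T q ξ) :=
    Summable.of_nonneg_of_le (hT0 q ξ) (hTle q ξ) ((hprod q hξ).mul_left _)
  refine ⟨V, fun ξ hξ q => (hsummable q ξ).mpr (hTsum q hξ), fun ξ _ hVξ => ?_,
    fun q => ⟨σ (R q), B q * √(4 / 3), mul_pos (hBpos q) (by positivity), fun ξ hξ => ?_⟩,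
    fun q => ⟨q, 1 / D q, one_div_pos.mpr (hD q), fun ξ hξ => ?_⟩⟩
  · funext j
    have h := hVn ξ (j, 0)
    rw [hVξ, Pi.zero_apply, eq_comm, mul_eq_zero] at h
    exact h.resolve_left (Complex.ofReal_ne_zero.mpr (hc _).ne')
  · rw [hsNorm]
    refine Real.sqrt_le_iff.mpr
      ⟨mul_nonneg (mul_nonneg (hBpos q).le (Real.sqrt_nonneg _)) (lam2Norm_nonneg _ _ _), ?_⟩
    rw [mul_pow, mul_pow, lam2Norm_sq, Real.sq_sqrt (by norm_num)]
    calc ∑' x, T q ξ x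
        ≤ ∑' x : ℕ × ℕ, B q ^ 2 * ((‖ξ x.1‖ ^ 2 * a x.1 (σ (R q)) ^ 2) * (1 / 4) ^ x.2) :=
          (hTsum q hξ).tsum_le_tsum (hTle q ξ) ((hprod q hξ).mul_left _)
      _ = B q ^ 2 * ((∑' j, ‖ξ j‖ ^ 2 * a j (σ (R q)) ^ 2) * (4 / 3)) := by
          rw [tsum_mul_left, ← hgeom4.tsum_eq,
            (hξ (σ (R q))).tsum_mul_tsum hgeom4.summable (hprod q hξ)]
      _ = _ := by ring
  · rw [hsNorm]
    refine Real.sqrt_le_iff.mpr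
      ⟨mul_nonneg (one_div_pos.mpr (hD q)).le (Real.sqrt_nonneg _), ?_⟩
    rw [mul_pow, Real.sq_sqrt (tsum_nonneg (hT0 q ξ)), ← tsum_mul_left]
    refine Summable.tsum_le_tsum_of_inj (fun j => (j, q)) (fun i j h => (Prod.ext_iff.mp h).1)
      (fun x _ => mul_nonneg (sq_nonneg _) (hT0 q ξ x)) (fun j => ?_) (hξ q)
      ((hTsum q hξ).mul_left _)
    have hlow : a j q ≤ 1 / D q * (c (j, q) * ((n (j, q) : ℝ) + 1) ^ q) := by
      have h1 : a j q ≤ a j (σ q) := monotone_nat_of_le_succ (hA.2.2 j) (hσ q)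
      have h2 : w j q ^ q ≤ ((n (j, q) : ℝ) + 1) ^ q :=
        pow_le_pow_left₀ (hwpos j q).le (hnw (j, q)).1 q
      rw [one_div_mul_eq_div, le_div_iff₀ (hD q)]
      calc a j q * D q ≤ D q * a j (σ q) := by
            rw [mul_comm]
            exact mul_le_mul_of_nonneg_left h1 (hD q).le
        _ = c (j, q) * w j q ^ q := by
            have := (hwpos j q).ne'
            rw [← hbw]
            simp only [c]
            field_simp
        _ ≤ _ := mul_le_mul_of_nonneg_left h2 (hc _).le
    calc ‖ξ j‖ ^ 2 * a j q ^ 2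
        ≤ ‖ξ j‖ ^ 2 * (1 / D q * (c (j, q) * ((n (j, q) : ℝ) + 1) ^ q)) ^ 2 :=
          mul_le_mul_of_nonneg_left (pow_le_pow_left₀ (hA.1 _ _) hlow 2) (sq_nonneg _)
      _ = _ := by
          simp only [T]
          ring

/-- a Köthe matrix `A` satisfies the nuclearity condition (i) and the
(DN)-type condition (ii) if and only if `λ²(A)` admits a topological embedding into `s`. -/
theorem statement14 (a : ℕ → ℕ → ℝ) (hA : KotheMatrix a) :
    (NuclearityCond a ∧
      (∃ p : ℕ, ∀ q : ℕ, ∃ r : ℕ, ∃ C : ℝ, 0 < C ∧ ∀ j : ℕ, a j q ^ 2 ≤ C * a j p * a j r)) ↔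
    (∃ V : (ℕ → ℂ) →ₗ[ℂ] (ℕ → ℂ), IsTopEmbeddingIntoS a V) := by
  constructor
  · rintro ⟨hN, hD⟩
    obtain ⟨b, w, σ, D, hb, hσ, hDpos, hbw, h0, hsq, hsum⟩ := exists_squaring_weights hA hN hD
    exact exists_embedding hA hb hσ hDpos hbw h0 hsq hsum
  · rintro ⟨V, hV⟩
    exact ⟨nuclearityCond_of_embedding hA hV, dominatingNorm_of_embedding hA hV⟩
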